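/- arXiv:2411.19256 — 2 statements merged into one kernel-verified Lean document; each statement's English description precedes it below -/
import Mathlib

section
/- Every accumulation point x̄ of the iterate sequence (x^k) is an M-stationary point of the problem min q, i.e. 0 ∈ ∇f(x̄) + ∂g(x̄), and the common limit q_* of the sequences (q(x^k)) and (Φ_k) equals q(x̄). -/
open Filter Topology Set Metric Pointwise RealInnerProductSpace

/-- The Fréchet (regular) subdifferential of an extended-real-valued function. -/
noncomputable def frechetSubdiff {X : Type*} [NormedAddCommGroup X] [InnerProductSpace ℝ X]
    (q : X → EReal) (x : X) : Set X :=
  {v | 0 ≤ Filter.liminf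
      (fun y => (q y - q x - ((⟪v, y - x⟫ : ℝ) : EReal)) / ((‖y - x‖ : ℝ) : EReal))
      (nhdsWithin x {x}ᶜ)}

/-- The limiting (Mordukhovich) subdifferential of an extended-real-valued function. -/
noncomputable def limitingSubdiff {X : Type*} [NormedAddCommGroup X] [InnerProductSpace ℝ X]
    (q : X → EReal) (x : X) : Set X :=
  {v | ∃ (xs : ℕ → X) (vs : ℕ → X),
      Filter.Tendsto xs Filter.atTop (nhds x) ∧
      Filter.Tendsto (fun j => q (xs j)) Filter.atTop (nhds (q x)) ∧
      Filter.Tendsto vs Filter.atTop (nhds v) ∧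
      ∀ j, vs j ∈ frechetSubdiff q (xs j)}

lemma aux_descent {X : Type*} [NormedAddCommGroup X] [InnerProductSpace ℝ X]
    [FiniteDimensional ℝ X] (f : X → ℝ) (hf : ContDiff ℝ 1 f) (K : NNReal) (t : Set X)
    (ht : Convex ℝ t) (hL : LipschitzOnWith K (fun y => gradient f y) t) (u w : X)
    (hu : u ∈ t) (hw : w ∈ t) :
    f w ≤ f u + ⟪gradient f u, w - u⟫ + K * ‖w - u‖ ^ 2 := by
  have hd : Differentiable ℝ f := hf.differentiable (by norm_num)
  have key := Convex.norm_image_sub_le_of_norm_hasFDerivWithin_le' (𝕜 := ℝ) (f := f)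
    (f' := fun z => fderiv ℝ f z) (s := segment ℝ u w) (x := u) (y := w)
    (φ := fderiv ℝ f u) (C := K * ‖w - u‖)
    (fun z _ => (hd z).hasFDerivAt.hasFDerivWithinAt)
    (fun z hz => by
      have hz' : z ∈ t := ht.segment_subset hu hw hz
      have h1 := hL.dist_le_mul z hz' u hu
      rw [dist_eq_norm, dist_eq_norm] at h1
      have h2 : ‖gradient f z - gradient f u‖ = ‖fderiv ℝ f z - fderiv ℝ f u‖ := by
        unfold gradient
        rw [← map_sub, LinearIsometryEquiv.norm_map]
      have h3 : ‖z - u‖ ≤ ‖w - u‖ := by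
        obtain ⟨a, b, ha, hb, hab, rfl⟩ := hz
        have : a • u + b • w - u = b • (w - u) := by
          have : a = 1 - b := by linarith
          subst this
          module
        rw [this, norm_smul, Real.norm_of_nonneg hb]
        nlinarith [norm_nonneg (w - u)]
      rw [← h2]
      exact h1.trans (mul_le_mul_of_nonneg_left h3 K.2))
    (convex_segment u w) (left_mem_segment ℝ u w) (right_mem_segment ℝ u w)
  have h4 : fderiv ℝ f u (w - u) = ⟪gradient f u, w - u⟫ := by
    unfold gradient
    rw [InnerProductSpace.toDual_symm_apply]
  rw [h4] at key
  have := (abs_le.mp ((Real.norm_eq_abs _) ▸ key)).2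
  nlinarith

lemma aux_frechet {X : Type*} [NormedAddCommGroup X] [InnerProductSpace ℝ X]
    (g : X → EReal) (hbot : ∀ y, g y ≠ ⊥) (z v : X) (C Gz : ℝ) (hz : g z = (Gz : EReal))
    (h : ∀ y G, g y = ((G : ℝ) : EReal) → Gz + ⟪v, y - z⟫ - C * ‖y - z‖ ^ 2 ≤ G) :
    v ∈ frechetSubdiff g z := by
  show (0 : EReal) ≤ _
  refine le_of_forall_lt fun a ha => ?_
  obtain ⟨a', haa, ha0⟩ := EReal.lt_iff_exists_real_btwn.1 ha
  have ha0' : a' < 0 := by exact_mod_cast ha0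
  refine lt_of_lt_of_le haa ?_
  refine le_liminf_of_le (by isBoundedDefault) ?_
  have ht : Tendsto (fun y => -(C * ‖y - z‖)) (𝓝[≠] z) (𝓝 0) := by
    have : Continuous (fun y => -(C * ‖y - z‖)) := by fun_prop
    have h2 := this.tendsto z
    simp only [sub_self, norm_zero, mul_zero, neg_zero] at h2
    exact h2.mono_left nhdsWithin_le_nhds
  filter_upwards [ht.eventually (lt_mem_nhds ha0'), self_mem_nhdsWithin] with y hy hne
  have hpos : 0 < ‖y - z‖ := norm_pos_iff.2 (sub_ne_zero.2 hne)
  rw [hz]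
  induction hG : g y using EReal.rec with
  | bot => exact absurd hG (hbot y)
  | top =>
    rw [EReal.top_sub_coe, EReal.top_sub_coe, EReal.top_div_of_pos_ne_top (by exact_mod_cast hpos) (EReal.coe_ne_top _)]
    exact le_top
  | coe G =>
    have := h y G hG
    rw [← EReal.coe_sub, ← EReal.coe_sub, ← EReal.coe_div, EReal.coe_le_coe_iff, le_div_iff₀ hpos]
    nlinarith

lemma aux_gamma {X : Type*} [NormedAddCommGroup X] [InnerProductSpace ℝ X]
    [FiniteDimensional ℝ X]
    (f : X → ℝ) (g : X → EReal) (hf : ContDiff ℝ 1 f)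
    (b : X) (c : ℝ) (hb : ∀ y, ((⟪b, y⟫ + c : ℝ) : EReal) ≤ g y)
    (hgrad_lip : LocallyLipschitz (fun y => gradient f y))
    (τ δ Φ0 : ℝ) (hτ : 1 < τ) (hδ : δ < 1) (xbar : X) :
    ∃ r > 0, ∃ M : ℝ, ∀ (u xh : X) (γ Φ Gu : ℝ), 0 < γ → dist u xbar < r →
      g u = (Gu : EReal) → f u + Gu ≤ Φ → Φ ≤ Φ0 →
      (((f u + ⟪gradient f u, xh - u⟫
          + (γ / τ) / 2 * ‖xh - u‖ ^ 2 : ℝ) : EReal) + g xh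
        ≤ ((f u + ⟪gradient f u, u - u⟫
          + (γ / τ) / 2 * ‖u - u‖ ^ 2 : ℝ) : EReal) + g u)
      → ((Φ - δ * γ / (2 * τ) * ‖xh - u‖ ^ 2 : ℝ) : EReal) < (f xh : EReal) + g xh
      → γ ≤ M := by
  obtain ⟨K, t, ht, hL⟩ := hgrad_lip xbar
  have hfc : ∀ᶠ y in 𝓝 xbar, f xbar - 1 < f y :=
    hf.continuous.tendsto xbar |>.eventually (lt_mem_nhds (by linarith))
  have hgc : ∀ᶠ y in 𝓝 xbar, ‖gradient f y‖ < ‖gradient f xbar‖ + 1 :=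
    (hgrad_lip.continuous.norm.tendsto xbar).eventually (gt_mem_nhds (by simp))
  obtain ⟨R, hR, hball⟩ := Metric.eventually_nhds_iff.1 (hfc.and (hgc.and ht))
  set D := ‖gradient f xbar‖ + 1
  set r := R / 2 with hr
  have hrpos : 0 < r := by positivity
  set A := |Φ0 - f xbar + 1 + ‖b‖ * (‖xbar‖ + r) - c| with hA
  set B := ‖b‖ + D
  have hB : 0 ≤ B := by positivity
  have hτ0 : 0 < τ := by linarith
  refine ⟨r, hrpos, max (2 * τ * (A / r ^ 2 + B / r)) (2 * τ * (K / (1 - δ))), ?_⟩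
  intro u xh γ Φ Gu hγ hu hGu hΦ hΦ0 hmin hrej
  obtain ⟨hfu, hgu, htu⟩ := hball (y := u) (by linarith)
  obtain ⟨Gh, hGh⟩ : ∃ Gh : ℝ, g xh = Gh := by
    induction hG : g xh using EReal.rec with
    | bot => exact absurd (hG ▸ hb xh) (by simp)
    | top =>
      rw [hG, hGu, EReal.coe_add_top] at hmin
      exact absurd (top_le_iff.1 hmin) (by norm_cast)
    | coe G => exact ⟨G, rfl⟩
  have hbh := hb xh
  rw [hGh] at hbh hmin hrej
  rw [hGu] at hmin
  simp only [sub_self, inner_zero_right, norm_zero, zero_pow two_ne_zero, mul_zero, add_zero] at hmin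
  norm_cast at hbh hmin hrej
  set s := ‖xh - u‖ with hs
  have hs0 : 0 ≤ s := norm_nonneg _
  have e1 : γ / τ / 2 = γ / (2 * τ) := by field_simp
  have e2 : δ * γ / (2 * τ) = δ * (γ / (2 * τ)) := by ring
  rw [e1] at hmin
  rw [e2] at hrej
  have e3 : γ = 2 * τ * (γ / (2 * τ)) := by field_simp
  have hη0 : 0 < γ / (2 * τ) := by positivity
  rw [e3]
  set η := γ / (2 * τ)
  rw [← mul_max_of_nonneg _ _ (by positivity)]
  refine mul_le_mul_of_nonneg_left ?_ (by positivity)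
  rw [le_max_iff]
  by_cases hsr : s < r
  · right
    have hxh : dist xh xbar < R := by
      have := dist_triangle xh u xbar
      rw [dist_eq_norm xh u] at this
      linarith
    have hd := aux_descent f hf K (Metric.ball xbar R) (convex_ball _ _)
      (hL.mono fun y hy => (hball hy).2.2) u xh
      (by rw [Metric.mem_ball]; linarith) hxh
    rw [← hs] at hd
    rw [le_div_iff₀ (by linarith)]
    by_contra hcon
    push Not at hcon
    nlinarith [sq_nonneg s]
  · left
    push Not at hsr
    have i1 : -(D * s) ≤ ⟪gradient f u, xh - u⟫ := by
      have := (abs_le.1 (abs_real_inner_le_norm (gradient f u) (xh - u))).1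
      have := mul_le_mul_of_nonneg_right hgu.le hs0
      linarith
    have i2 : -(‖b‖ * (‖xbar‖ + r + s)) ≤ ⟪b, xh⟫ := by
      have h1 := (abs_le.1 (abs_real_inner_le_norm b xh)).1
      have h2 : ‖xh‖ ≤ ‖xbar‖ + r + s := by
        have e : xh = xbar + (u - xbar) + (xh - u) := by abel
        have := norm_add₃_le (a := xbar) (b := u - xbar) (c := xh - u)
        rw [← e] at this
        rw [dist_eq_norm] at hu
        linarith
      have := mul_le_mul_of_nonneg_left h2 (norm_nonneg b)
      linarith
    have i3 : η * s ^ 2 ≤ A + B * s := by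
      have := le_abs_self (Φ0 - f xbar + 1 + ‖b‖ * (‖xbar‖ + r) - c)
      rw [← hA] at this
      simp only [B]
      nlinarith
    have hA0 : 0 ≤ A := abs_nonneg _
    have i4 : A ≤ A / r ^ 2 * s ^ 2 := by
      rw [div_mul_eq_mul_div, le_div_iff₀ (by positivity)]
      gcongr
    have i5 : B * s ≤ B / r * s ^ 2 := by
      rw [div_mul_eq_mul_div, le_div_iff₀ (by positivity)]
      have : B * s * r ≤ B * s * s := by gcongr
      linarith
    have hsp : 0 < s ^ 2 := by have : 0 < s := by linarith
                               positivity
    refine le_of_mul_le_mul_right ?_ hsp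
    linarith

theorem stmt9
    {X : Type*} [NormedAddCommGroup X] [InnerProductSpace ℝ X] [FiniteDimensional ℝ X]
    (f : X → ℝ) (g : X → EReal)
    (hf : ContDiff ℝ 1 f)
    (hg_lsc : LowerSemicontinuous g)
    (hg_proper : ∃ y, g y ≠ ⊤)
    (hq_bddbelow : ∃ c : ℝ, ∀ y, g y ≠ ⊤ → (c : EReal) ≤ (f y : EReal) + g y)
    (hg_affine : ∃ (b : X) (c : ℝ), ∀ y, ((⟪b, y⟫ + c : ℝ) : EReal) ≤ g y)
    (hgrad_lip : LocallyLipschitz (fun y => gradient f y))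
    (τ γmin γmax δ pmin : ℝ)
    (hτ : 1 < τ) (hγmin : 0 < γmin) (hγminmax : γmin ≤ γmax)
    (hδ : δ ∈ Set.Ioo (0:ℝ) 1) (hpmin : 4/5 ≤ pmin) (hpmin1 : pmin ≤ 1)
    (p : ℕ → ℝ) (hp : ∀ k, p k ∈ Set.Icc pmin 1)
    (x : ℕ → X) (γ : ℕ → ℝ) (Φ : ℕ → ℝ) (qx : ℕ → ℝ)
    (hdom : ∀ k, g (x k) ≠ ⊤)
    (hqx : ∀ k, (qx k : EReal) = (f (x k) : EReal) + g (x k))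
    (hγlb : ∀ k, γmin ≤ γ k)
    (hΦ0 : Φ 0 = qx 0)
    (hΦrec : ∀ k, Φ (k + 1) = (1 - p k) * Φ k + p k * qx (k + 1))
    (hstep : ∀ k, ∀ y : X,
      ((f (x k) + ⟪gradient f (x k), x (k + 1) - x k⟫
          + γ k / 2 * ‖x (k + 1) - x k‖ ^ 2 : ℝ) : EReal) + g (x (k + 1))
        ≤ ((f (x k) + ⟪gradient f (x k), y - x k⟫
          + γ k / 2 * ‖y - x k‖ ^ 2 : ℝ) : EReal) + g y)
    (haccept : ∀ k, qx (k + 1) ≤ Φ k - δ * γ k / 2 * ‖x (k + 1) - x k‖ ^ 2)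
    (htrial : ∀ k, γmax < γ k → ∃ xh : X,
      (∀ y : X, ((f (x k) + ⟪gradient f (x k), xh - x k⟫
          + (γ k / τ) / 2 * ‖xh - x k‖ ^ 2 : ℝ) : EReal) + g xh
        ≤ ((f (x k) + ⟪gradient f (x k), y - x k⟫
          + (γ k / τ) / 2 * ‖y - x k‖ ^ 2 : ℝ) : EReal) + g y)
      ∧ ((Φ k - δ * γ k / (2 * τ) * ‖xh - x k‖ ^ 2 : ℝ) : EReal) < (f xh : EReal) + g xh)
    (xbar : X) (hacc : MapClusterPt xbar Filter.atTop x) :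
    (0 : X) ∈ ({gradient f xbar} : Set X) + limitingSubdiff g xbar
    ∧ ∃ qstar : ℝ,
        Filter.Tendsto qx Filter.atTop (nhds qstar) ∧
        Filter.Tendsto Φ Filter.atTop (nhds qstar) ∧
        (qstar : EReal) = (f xbar : EReal) + g xbar := by
  obtain ⟨c0, hc0⟩ := hq_bddbelow
  obtain ⟨b, c, hb⟩ := hg_affine
  have hbot : ∀ y, g y ≠ ⊥ := fun y hy => absurd (hy ▸ hb y) (by simp)
  have hgx : ∀ k, g (x k) = ((qx k - f (x k) : ℝ) : EReal) := by
    intro k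
    have h := hqx k
    induction hG : g (x k) using EReal.rec with
    | bot => exact absurd hG (hbot _)
    | top => exact absurd hG (hdom _)
    | coe G =>
      rw [hG] at h
      norm_cast at h ⊢
      linarith
  have hp0 : ∀ k, 4 / 5 ≤ p k := fun k => hpmin.trans (hp k).1
  have hp1 : ∀ k, p k ≤ 1 := fun k => (hp k).2
  have hγ0 : ∀ k, 0 < γ k := fun k => hγmin.trans_le (hγlb k)
  have hδ0 := hδ.1
  have hdec : ∀ k, p k * (δ * γ k / 2 * ‖x (k + 1) - x k‖ ^ 2) ≤ Φ k - Φ (k + 1) := by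
    intro k
    rw [hΦrec]
    nlinarith [haccept k, hp0 k]
  have hnn : ∀ k, 0 ≤ δ * γ k / 2 * ‖x (k + 1) - x k‖ ^ 2 := fun k => by
    have := hγ0 k
    positivity
  have hanti : Antitone Φ := antitone_nat_of_succ_le fun k => by
    have := mul_nonneg (by linarith [hp0 k] : 0 ≤ p k) (hnn k)
    linarith [hdec k]
  have hqΦ : ∀ k, qx k ≤ Φ k := by
    intro k
    cases k with
    | zero => exact hΦ0.ge
    | succ k =>
      rw [hΦrec]
      nlinarith [haccept k, hp1 k, hnn k]
  have hqlb : ∀ k, c0 ≤ qx k := fun k => by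
    have := hc0 (x k) (hdom k)
    rw [← hqx k] at this
    exact_mod_cast this
  obtain ⟨qs, hΦlim⟩ : ∃ l, Tendsto Φ atTop (𝓝 l) :=
    ⟨_, tendsto_atTop_ciInf hanti ⟨c0, by rintro _ ⟨k, rfl⟩; exact (hqlb k).trans (hqΦ k)⟩⟩
  have hΦlim1 : Tendsto (fun k => Φ (k + 1)) atTop (𝓝 qs) := (tendsto_add_atTop_iff_nat 1).2 hΦlim
  have hdiff : Tendsto (fun k => Φ k - Φ (k + 1)) atTop (𝓝 0) := by
    simpa using hΦlim.sub hΦlim1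
  have hqlim1 : Tendsto (fun k => qx (k + 1)) atTop (𝓝 qs) := by
    have hlow : Tendsto (fun k => Φ k - 2 * (Φ k - Φ (k + 1))) atTop (𝓝 qs) := by
      simpa using hΦlim.sub (hdiff.const_mul 2)
    refine tendsto_of_tendsto_of_tendsto_of_le_of_le hlow hΦlim1 (fun k => ?_) (fun k => hqΦ _)
    have h1 := hΦrec k
    have h2 := hp0 k
    have h3 : 0 ≤ Φ k - Φ (k + 1) := by linarith [hanti (Nat.le_succ k)]
    have h4 : p k * (Φ k - qx (k + 1)) = Φ k - Φ (k + 1) := by rw [h1]; ring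
    have h5 : 0 ≤ Φ k - qx (k + 1) := by linarith [haccept k, hnn k]
    show Φ k - 2 * (Φ k - Φ (k + 1)) ≤ qx (k + 1)
    nlinarith
  have hqlim : Tendsto qx atTop (𝓝 qs) := (tendsto_add_atTop_iff_nat 1).1 hqlim1
  have hd0 : Tendsto (fun k => x (k + 1) - x k) atTop (𝓝 0) := by
    rw [tendsto_zero_iff_norm_tendsto_zero]
    have hsq : Tendsto (fun k => ‖x (k + 1) - x k‖ ^ 2) atTop (𝓝 0) := by
      have hup : Tendsto (fun k => (5 / 2 / (δ * γmin)) * (Φ k - Φ (k + 1))) atTop (𝓝 0) := by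
        simpa using hdiff.const_mul (5 / 2 / (δ * γmin))
      refine squeeze_zero (fun k => sq_nonneg _) (fun k => ?_) hup
      rw [div_mul_eq_mul_div, le_div_iff₀ (by positivity)]
      have h1 := hdec k
      have h2 : 4 / 5 * (δ * γ k / 2 * ‖x (k + 1) - x k‖ ^ 2)
          ≤ p k * (δ * γ k / 2 * ‖x (k + 1) - x k‖ ^ 2) :=
        mul_le_mul_of_nonneg_right (hp0 k) (hnn k)
      have h3 : ‖x (k + 1) - x k‖ ^ 2 * (δ * γmin) ≤ ‖x (k + 1) - x k‖ ^ 2 * (δ * γ k) := by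
        have := hγlb k
        gcongr
      linarith
    have := hsq.sqrt
    simpa [Real.sqrt_sq] using this
  obtain ⟨r, hr, M, hM⟩ := aux_gamma f g hf b c hb hgrad_lip τ δ (Φ 0) hτ hδ.2 xbar
  have hγM : ∀ k, dist (x k) xbar < r → γ k ≤ max γmax M := by
    intro k hk
    by_cases h : γ k ≤ γmax
    · exact h.trans (le_max_left _ _)
    · push Not at h
      obtain ⟨xh, h1, h2⟩ := htrial k h
      exact (hM (x k) xh (γ k) (Φ k) _ (hγ0 k) hk (hgx k) (by linarith [hqΦ k])
        (hanti (Nat.zero_le k)) (h1 (x k)) h2).trans (le_max_right _ _)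
  set N := max γmax M
  obtain ⟨ψ, hψ, hlim⟩ := MapClusterPt.tendsto_subseq hacc
  have hψt := hψ.tendsto_atTop
  have hlim0 : Tendsto (fun n => x (ψ n)) atTop (𝓝 xbar) := hlim
  have hdψ : Tendsto (fun n => x (ψ n + 1) - x (ψ n)) atTop (𝓝 0) := hd0.comp hψt
  have hlim1 : Tendsto (fun n => x (ψ n + 1)) atTop (𝓝 xbar) := by
    simpa using hlim0.add hdψ
  have hev : ∀ᶠ n in atTop, γ (ψ n) ≤ N := by
    filter_upwards [hlim0.eventually (Metric.ball_mem_nhds xbar hr)] with n hn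
    exact hγM _ hn
  have hGlim1 : Tendsto (fun n => qx (ψ n + 1) - f (x (ψ n + 1))) atTop (𝓝 (qs - f xbar)) :=
    (hqlim1.comp hψt).sub ((hf.continuous.tendsto xbar).comp hlim1)
  have hgl : Tendsto (fun n => g (x (ψ n + 1))) atTop (𝓝 ((qs - f xbar : ℝ) : EReal)) := by
    simp_rw [hgx]
    exact EReal.tendsto_coe.2 hGlim1
  have hle1 : g xbar ≤ ((qs - f xbar : ℝ) : EReal) := by
    refine le_of_forall_lt_imp_le_of_dense fun a ha => ?_
    exact ge_of_tendsto hgl ((hlim1.eventually (hg_lsc xbar a ha)).mono fun n hn => hn.le)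
  obtain ⟨Gb, hGb⟩ : ∃ Gb : ℝ, g xbar = Gb := by
    induction hG : g xbar using EReal.rec with
    | bot => exact absurd hG (hbot _)
    | top => rw [hG] at hle1; exact absurd (top_le_iff.1 hle1) (EReal.coe_ne_top _)
    | coe G => exact ⟨G, rfl⟩
  have hgradlim : Tendsto (fun n => gradient f (x (ψ n))) atTop (𝓝 (gradient f xbar)) :=
    (hgrad_lip.continuous.tendsto xbar).comp hlim0
  have hle2 : qs - f xbar ≤ Gb := by
    have hL : Tendsto (fun n => ⟪gradient f (x (ψ n)), x (ψ n + 1) - x (ψ n)⟫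
        + (qx (ψ n + 1) - f (x (ψ n + 1)))) atTop (𝓝 (qs - f xbar)) := by
      simpa using (hgradlim.inner hdψ (𝕜 := ℝ)).add hGlim1
    have hxd : Tendsto (fun n => xbar - x (ψ n)) atTop (𝓝 0) := by
      simpa using hlim0.const_sub xbar
    have hRt : Tendsto (fun n => ⟪gradient f (x (ψ n)), xbar - x (ψ n)⟫
        + N / 2 * ‖xbar - x (ψ n)‖ ^ 2 + Gb) atTop (𝓝 Gb) := by
      simpa using ((hgradlim.inner hxd (𝕜 := ℝ)).add ((hxd.norm.pow 2).const_mul (N / 2))).add_const Gb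
    refine le_of_tendsto_of_tendsto hL hRt ?_
    filter_upwards [hev] with n hn
    have h := hstep (ψ n) xbar
    rw [hgx, hGb] at h
    norm_cast at h
    have h1 : γ (ψ n) / 2 * ‖xbar - x (ψ n)‖ ^ 2 ≤ N / 2 * ‖xbar - x (ψ n)‖ ^ 2 := by gcongr
    have h2 : 0 ≤ γ (ψ n) / 2 * ‖x (ψ n + 1) - x (ψ n)‖ ^ 2 := by
      have := hγ0 (ψ n)
      positivity
    linarith
  have hEq : Gb = qs - f xbar := by
    rw [hGb] at hle1
    exact le_antisymm (by exact_mod_cast hle1) hle2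
  refine ⟨?_, qs, hqlim, hΦlim, ?_⟩
  · refine Set.mem_add.2 ⟨gradient f xbar, rfl, -gradient f xbar, ?_, by simp⟩
    refine ⟨fun n => x (ψ n + 1),
      fun n => -gradient f (x (ψ n)) - γ (ψ n) • (x (ψ n + 1) - x (ψ n)), hlim1, ?_, ?_, ?_⟩
    · rw [hGb, hEq]
      exact hgl
    · have hs : Tendsto (fun n => γ (ψ n) • (x (ψ n + 1) - x (ψ n))) atTop (𝓝 0) := by
        rw [tendsto_zero_iff_norm_tendsto_zero]
        have hN : Tendsto (fun n => N * ‖x (ψ n + 1) - x (ψ n)‖) atTop (𝓝 0) := by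
          simpa using hdψ.norm.const_mul N
        refine squeeze_zero' (Eventually.of_forall fun n => norm_nonneg _) ?_ hN
        filter_upwards [hev] with n hn
        rw [norm_smul, Real.norm_of_nonneg (hγ0 _).le]
        gcongr
      simpa using hgradlim.neg.sub hs
    · intro n
      refine aux_frechet g hbot _ _ (γ (ψ n) / 2) _ (hgx _) fun y G hG => ?_
      have h := hstep (ψ n) y
      rw [hgx, hG] at h
      norm_cast at h
      have e : y - x (ψ n) = (y - x (ψ n + 1)) + (x (ψ n + 1) - x (ψ n)) := by abel
      rw [e, norm_add_sq_real, inner_add_right] at h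
      rw [inner_sub_left, inner_neg_left, real_inner_smul_left,
        real_inner_comm (y - x (ψ n + 1)) (x (ψ n + 1) - x (ψ n))]
      linarith
  · rw [hGb, hEq]
    norm_cast
    ring
end

section
/- Assume p_min > 4/5. If some subsequence (x^k)_{k ∈ K} of the iterates converges to a point x̄ and q has the KL property at x̄, then the entire sequence (x^k) converges to x̄. -/
open Filter Topology Set Metric Pointwise RealInnerProductSpace

/-- `χ` (with derivative `χ'` on `(0, η)`) is a desingularization function witnessing the
Kurdyka-Łojasiewicz property of `q` at `xb` with constant `η`. -/
noncomputable def IsKLDesingularizer {X : Type*} [NormedAddCommGroup X] [InnerProductSpace ℝ X]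
    (q : X → EReal) (xb : X) (η : ℝ) (χ χ' : ℝ → ℝ) : Prop :=
  0 < η ∧ χ 0 = 0 ∧ (∀ t ∈ Set.Icc 0 η, 0 ≤ χ t) ∧
  ContinuousOn χ (Set.Icc 0 η) ∧ ConcaveOn ℝ (Set.Icc 0 η) χ ∧
  ContinuousOn χ' (Set.Ioo 0 η) ∧
  (∀ t ∈ Set.Ioo 0 η, HasDerivAt χ (χ' t) t ∧ 0 < χ' t) ∧
  ∃ U ∈ nhds xb, ∀ y ∈ U, q xb < q y → q y < q xb + (η : EReal) →
    1 ≤ ENNReal.ofReal (χ' ((q y - q xb).toReal)) * EMetric.infEdist (0 : X) (limitingSubdiff q y)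

/-- `q` has the Kurdyka-Łojasiewicz property at `xb`. -/
noncomputable def HasKLProperty {X : Type*} [NormedAddCommGroup X] [InnerProductSpace ℝ X]
    (q : X → EReal) (xb : X) : Prop :=
  ∃ (η : ℝ) (χ χ' : ℝ → ℝ), IsKLDesingularizer q xb η χ χ'


lemma npg_abs_conv {X : Type*} [NormedAddCommGroup X] (x : ℕ → X) (xbar : X) (V : ℕ → ℝ)
    (φ : ℕ → ℕ) (hφ : StrictMono φ) (K0 : ℕ) (R : ℝ) (hR : 0 < R)
    (hconv : Tendsto (fun j => x (φ j)) atTop (𝓝 xbar))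
    (hd : Tendsto (fun k => ‖x (k+1) - x k‖) atTop (𝓝 0))
    (hV : Tendsto V atTop (𝓝 0)) (hV0 : ∀ k, K0 ≤ k → 0 ≤ V k)
    (hstep : ∀ k, K0 ≤ k → ‖x k - xbar‖ < R → ‖x (k+1) - xbar‖ < R →
      ‖x (k+2) - x (k+1)‖ ≤ V k - V (k+1)) :
    Tendsto x atTop (𝓝 xbar) := by
  rw [Metric.tendsto_atTop]
  intro ε0 hε0
  set ε := min ε0 R with hε
  have hεp : 0 < ε := lt_min hε0 hR
  have h1 : ∀ᶠ j in atTop, dist (x (φ j)) xbar < ε/3 :=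
    (Metric.tendsto_nhds.1 hconv) _ (by positivity)
  have h2 : ∀ᶠ j in atTop, ‖x (φ j+1) - x (φ j)‖ < ε/3 :=
    (hd.comp hφ.tendsto_atTop).eventually (gt_mem_nhds (by positivity))
  have h3 : ∀ᶠ j in atTop, V (φ j) < ε/3 :=
    (hV.comp hφ.tendsto_atTop).eventually (gt_mem_nhds (by positivity))
  have h4 : ∀ᶠ j in atTop, K0 ≤ φ j := hφ.tendsto_atTop.eventually (eventually_ge_atTop K0)
  obtain ⟨j, h1, h2, h3, h4⟩ := (h1.and (h2.and (h3.and h4))).exists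
  rw [dist_eq_norm] at h1
  have key : ∀ n, φ j ≤ n → ‖x n - xbar‖ < ε ∧ ‖x (n+1) - xbar‖ + V n < ε := by
    intro n hn
    induction n, hn using Nat.le_induction with
    | base =>
      refine ⟨by linarith, ?_⟩
      have := norm_sub_le_norm_sub_add_norm_sub (x (φ j + 1)) (x (φ j)) xbar
      linarith
    | succ n hn ih =>
      have hk : K0 ≤ n := h4.trans hn
      have hVn := hV0 n hk
      have h5 : ‖x (n+1) - xbar‖ < ε := by linarith [ih.2]
      refine ⟨h5, ?_⟩
      have hs := hstep n hk (lt_of_lt_of_le ih.1 (min_le_right _ _))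
        (lt_of_lt_of_le h5 (min_le_right _ _))
      have := norm_sub_le_norm_sub_add_norm_sub (x (n + 2)) (x (n+1)) xbar
      have e : n + 1 + 1 = n + 2 := rfl
      rw [e]
      linarith [ih.2]
  refine ⟨φ j, fun n hn => ?_⟩
  rw [dist_eq_norm]
  exact lt_of_lt_of_le (key n hn).1 (min_le_left _ _)

lemma npg_chi_mono {η : ℝ} {χ χ' : ℝ → ℝ} (hc : ContinuousOn χ (Set.Icc 0 η))
    (hd : ∀ t ∈ Set.Ioo 0 η, HasDerivAt χ (χ' t) t ∧ 0 < χ' t) :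
    MonotoneOn χ (Set.Icc 0 η) := by
  apply monotoneOn_of_deriv_nonneg (convex_Icc _ _) hc
  · rw [interior_Icc]
    exact fun t ht => (hd t ht).1.differentiableAt.differentiableWithinAt
  · rw [interior_Icc]
    intro t ht
    rw [(hd t ht).1.deriv]; exact (hd t ht).2.le

lemma npg_chi_tangent {η : ℝ} {χ χ' : ℝ → ℝ} (hc : ConcaveOn ℝ (Set.Icc 0 η) χ)
    (hd : ∀ t ∈ Set.Ioo 0 η, HasDerivAt χ (χ' t) t ∧ 0 < χ' t)
    {s t : ℝ} (hs : 0 ≤ s) (hst : s ≤ t) (ht : t ∈ Set.Ioo 0 η) :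
    χ' t * (t - s) ≤ χ t - χ s := by
  rcases hst.eq_or_lt with rfl | h
  · simp
  have := hc.le_slope_of_hasDerivAt (x := s) (y := t) ⟨hs, hst.trans ht.2.le⟩ ⟨ht.1.le, ht.2.le⟩ h (hd t ht).1
  rw [slope_def_field, le_div_iff₀ (by linarith)] at this
  exact this

lemma npg_chi_anti {η : ℝ} {χ χ' : ℝ → ℝ} (hc : ConcaveOn ℝ (Set.Icc 0 η) χ)
    (hd : ∀ t ∈ Set.Ioo 0 η, HasDerivAt χ (χ' t) t ∧ 0 < χ' t)
    {s t : ℝ} (hst : s ≤ t) (hs : s ∈ Set.Ioo 0 η) (ht : t ∈ Set.Ioo 0 η) :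
    χ' t ≤ χ' s := by
  rcases hst.eq_or_lt with rfl | h
  · simp
  have h1 := hc.le_slope_of_hasDerivAt (x := s) (y := t) ⟨hs.1.le, hs.2.le⟩ ⟨ht.1.le, ht.2.le⟩ h (hd t ht).1
  have h2 := hc.slope_le_of_hasDerivAt (x := s) (y := t) ⟨hs.1.le, hs.2.le⟩ ⟨ht.1.le, ht.2.le⟩ h (hd s hs).1
  exact h1.trans h2

lemma npg_step_ineq {η : ℝ} {χ χ' : ℝ → ℝ} (hcc : ConcaveOn ℝ (Set.Icc 0 η) χ)
    (hc : ContinuousOn χ (Set.Icc 0 η))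
    (hd : ∀ t ∈ Set.Ioo 0 η, HasDerivAt χ (χ' t) t ∧ 0 < χ' t)
    {a a1 a2 r p d d1 c M : ℝ} (hcp : 0 < c) (hM : 0 ≤ M) (hp : 4/5 ≤ p) (hp1 : p ≤ 1)
    (h2 : 0 ≤ a2) (h21 : a2 ≤ a1) (h10 : a1 ≤ a) (haη : a1 < η) (hd0 : 0 ≤ d) (hd1 : 0 ≤ d1)
    (hrec : a1 = (1-p)*a + p*r) (hra : r ≤ a1)
    (hdec : c * d1^2 ≤ a1 - a2)
    (hKL : 0 < r → r < η → 1 ≤ χ' r * (M * d)) :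
    d1 ≤ d/2 + (M/c * (χ (a1/2) - χ (a2/2)) + 2/√c * (√a - √a1)) := by
  have hD : χ (a2/2) ≤ χ (a1/2) := npg_chi_mono hc hd ⟨by linarith, by linarith⟩
    ⟨by linarith, by linarith⟩ (by linarith)
  have hS : √a1 ≤ √a := Real.sqrt_le_sqrt h10
  have hsc : 0 < √c := Real.sqrt_pos.2 hcp
  have t1 : 0 ≤ M/c * (χ (a1/2) - χ (a2/2)) := mul_nonneg (by positivity) (by linarith)
  have t2 : 0 ≤ 2/√c * (√a - √a1) := mul_nonneg (by positivity) (by linarith)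
  rcases le_or_gt (a1/2) r with hr | hr
  · rcases (h2.trans h21).eq_or_lt with h0 | h0
    · have : c * d1^2 ≤ 0 := by linarith
      have : d1 = 0 := by
        by_contra hne
        have : 0 < d1 := lt_of_le_of_ne hd1 (Ne.symm hne)
        have : 0 < c * d1^2 := by positivity
        linarith
      rw [this]; linarith
    have hrp : 0 < r := by linarith
    have hrη : r < η := by linarith
    have hk := hKL hrp hrη
    have hIt : a1/2 ∈ Set.Ioo 0 η := ⟨by linarith, by linarith⟩
    have ha := npg_chi_anti hcc hd hr hIt ⟨hrp, hrη⟩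
    have ht := npg_chi_tangent hcc hd (s := a2/2) (by linarith) (by linarith) hIt
    set D := χ (a1/2) - χ (a2/2) with hDdef
    have hMd : 0 ≤ M * d := by positivity
    have hk2 : 1 ≤ χ' (a1/2) * (M * d) := hk.trans (mul_le_mul_of_nonneg_right ha hMd)
    have e1 : χ' (a1/2) * (c * d1^2 / 2) ≤ D :=
      (mul_le_mul_of_nonneg_left (by linarith) (hd _ hIt).2.le).trans ht
    have e2 : c * d1^2 / 2 ≤ M * d * D := by
      have h3 := mul_le_mul_of_nonneg_left e1 hMd
      have h4 := mul_le_mul_of_nonneg_right hk2 (show 0 ≤ c * d1^2/2 by positivity)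
      nlinarith
    have e3 : d1^2 ≤ 2 * d * (M/c * D) := by
      have : 2 * d * (M/c*D) = 2 * (M * d * D) / c := by field_simp
      rw [this, le_div_iff₀ hcp]; linarith
    have : d1 ≤ d/2 + M/c*D := by
      apply le_of_sq_le_sq _ (by linarith) 
      nlinarith [sq_nonneg (d/2 - M/c*D)]
    linarith
  · have ha1 : a1 ≤ 4/9 * a := by nlinarith
    have ha : 0 ≤ a := by linarith
    have hs1 : √a1 ≤ 2/3 * √a := by
      rw [Real.sqrt_le_left (by positivity)]
      rw [mul_pow, Real.sq_sqrt ha]; linarith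
    have hd1' : d1 ≤ 1/√c * √a1 := by
      apply le_of_sq_le_sq _ (by positivity)
      rw [mul_pow, div_pow, Real.sq_sqrt hcp.le, Real.sq_sqrt (by linarith), one_pow, one_div_mul_eq_div, le_div_iff₀ hcp]
      linarith
    have : 1/√c * √a1 ≤ 2/√c * (√a - √a1) := by
      have e : 2/√c * (√a - √a1) = 1/√c * (2 * (√a - √a1)) := by ring
      rw [e]
      exact mul_le_mul_of_nonneg_left (by linarith) (by positivity)
    linarith

section
variable {X : Type*} [NormedAddCommGroup X] [InnerProductSpace ℝ X] [FiniteDimensional ℝ X]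

lemma npg_grad_lip (f : X → ℝ) (hgrad_lip : LocallyLipschitz (fun y => gradient f y))
    (xbar : X) (R : ℝ) :
    ∃ L : ℝ, 0 ≤ L ∧ ∀ a ∈ closedBall xbar R, ∀ b ∈ closedBall xbar R,
      ‖gradient f a - gradient f b‖ ≤ L * ‖a - b‖ := by
  have := (hgrad_lip.locallyLipschitzOn (s := closedBall xbar R)).exists_lipschitzOnWith_of_compact
    (isCompact_closedBall xbar R)
  obtain ⟨K, hK⟩ := this
  refine ⟨K, K.2, fun a ha b hb => ?_⟩
  exact hK.norm_sub_le ha hb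

lemma npg_descent (f : X → ℝ) (hf : ContDiff ℝ 1 f) (xbar : X) (R L : ℝ) (hL0 : 0 ≤ L)
    (hL : ∀ a ∈ closedBall xbar R, ∀ b ∈ closedBall xbar R,
      ‖gradient f a - gradient f b‖ ≤ L * ‖a - b‖) (a b : X)
    (ha : a ∈ closedBall xbar R) (hb : b ∈ closedBall xbar R) :
    f b ≤ f a + ⟪gradient f a, b - a⟫ + L * ‖b - a‖^2 := by
  have hdiff : Differentiable ℝ f := hf.differentiable (by norm_num)
  have hseg : segment ℝ a b ⊆ closedBall xbar R := (convex_closedBall xbar R).segment_subset ha hb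
  have h := (convex_segment a b).norm_image_sub_le_of_norm_hasFDerivWithin_le' (𝕜 := ℝ) (f := f)
    (f' := fun z => (InnerProductSpace.toDual ℝ X) (gradient f z))
    (φ := (InnerProductSpace.toDual ℝ X) (gradient f a)) (C := L * ‖b - a‖) (x := a) (y := b)
    (fun z hz => (hdiff z).hasGradientAt.hasFDerivAt.hasFDerivWithinAt)
    (fun z hz => by
      rw [← map_sub, LinearIsometryEquiv.norm_map]
      refine (hL z (hseg hz) a ha).trans (mul_le_mul_of_nonneg_left ?_ hL0)
      exact norm_sub_le_of_mem_segment hz)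
    (left_mem_segment ℝ a b) (right_mem_segment ℝ a b)
  rw [InnerProductSpace.toDual_apply_apply, Real.norm_eq_abs] at h
  have := (abs_le.1 h).2
  nlinarith

lemma npg_frechet (f : X → ℝ) (g : X → EReal) (hf : ContDiff ℝ 1 f)
    (hbot : ∀ y, g y ≠ ⊥) (u w : X) (gw γ : ℝ) (hgw : g w = gw)
    (hstep : ∀ y : X,
      ((f u + ⟪gradient f u, w - u⟫ + γ / 2 * ‖w - u‖ ^ 2 : ℝ) : EReal) + g w
        ≤ ((f u + ⟪gradient f u, y - u⟫ + γ / 2 * ‖y - u‖ ^ 2 : ℝ) : EReal) + g y) :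
    gradient f w - gradient f u - γ • (w - u) ∈ frechetSubdiff (fun y => (f y : EReal) + g y) w := by
  have hdiff : Differentiable ℝ f := hf.differentiable (by norm_num)
  have hlo := (hdiff w).hasGradientAt.hasFDerivAt.isLittleO
  rw [frechetSubdiff, Set.mem_ofPred_eq]
  have main : ∀ ε : ℝ, 0 < ε → ((-ε : ℝ) : EReal) ≤ liminf
      (fun y => ((f y : EReal) + g y - ((f w : EReal) + g w) -
        ((⟪gradient f w - gradient f u - γ • (w - u), y - w⟫ : ℝ) : EReal)) / ((‖y - w‖ : ℝ) : EReal))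
      (𝓝[≠] w) := by
    intro ε hε
    refine le_liminf_of_le (by isBoundedDefault) ?_
    have e1 := hlo.def (half_pos hε)
    have e2 : ∀ᶠ y in 𝓝 w, |γ| * ‖y - w‖ < ε := by
      have : Tendsto (fun y => |γ| * ‖y - w‖) (𝓝 w) (𝓝 (|γ| * ‖w - w‖)) :=
        (Continuous.tendsto (by fun_prop) w)
      simp only [sub_self, norm_zero, mul_zero] at this
      exact this.eventually (gt_mem_nhds hε)
    filter_upwards [e1.filter_mono nhdsWithin_le_nhds, e2.filter_mono nhdsWithin_le_nhds,
      self_mem_nhdsWithin] with y h1 h2 h3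
    have hn : 0 < ‖y - w‖ := norm_pos_iff.2 (sub_ne_zero.2 h3)
    rw [hgw]
    by_cases hy : g y = ⊤
    · rw [hy, EReal.coe_add_top, ← EReal.coe_add, EReal.top_sub_coe, EReal.top_sub_coe,
        EReal.top_div_of_pos_ne_top (by exact_mod_cast hn) (EReal.coe_ne_top _)]
      exact le_top
    · obtain ⟨gy, hgy⟩ : ∃ r : ℝ, g y = r := ⟨(g y).toReal, (EReal.coe_toReal hy (hbot y)).symm⟩
      have hs := hstep y
      rw [hgw, hgy] at hs
      rw [hgy]
      norm_cast at hs ⊢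
      rw [← EReal.coe_div, EReal.coe_le_coe_iff, le_div_iff₀ hn]
      rw [InnerProductSpace.toDual_apply_apply, Real.norm_eq_abs] at h1
      have h1' := (abs_le.1 h1).1
      have ed : y - u = (y - w) + (w - u) := by abel
      rw [ed, norm_add_sq_real, inner_add_right] at hs
      rw [inner_sub_left, inner_sub_left, real_inner_smul_left, real_inner_comm (y - w) (w - u)]
      have hg : γ/2 * ‖y-w‖^2 ≤ ε/2 * ‖y - w‖ := by
        have : γ ≤ |γ| := le_abs_self γ
        nlinarith [mul_le_mul_of_nonneg_right this hn.le]
      nlinarith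
  by_contra hcon
  push Not at hcon
  obtain ⟨z, hz1, hz2⟩ := EReal.lt_iff_exists_real_btwn.1 hcon
  have hz0 : z < 0 := by exact_mod_cast hz2
  have := main (-z) (by linarith)
  rw [neg_neg] at this
  exact absurd hz1 (not_lt.2 this)

lemma npg_infEdist (f : X → ℝ) (g : X → EReal) (hf : ContDiff ℝ 1 f)
    (hbot : ∀ y, g y ≠ ⊥) (u w : X) (gw γ L : ℝ) (hγ : 0 ≤ γ) (hgw : g w = gw)
    (hL : ‖gradient f w - gradient f u‖ ≤ L * ‖w - u‖)
    (hstep : ∀ y : X,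
      ((f u + ⟪gradient f u, w - u⟫ + γ / 2 * ‖w - u‖ ^ 2 : ℝ) : EReal) + g w
        ≤ ((f u + ⟪gradient f u, y - u⟫ + γ / 2 * ‖y - u‖ ^ 2 : ℝ) : EReal) + g y) :
    Metric.infEDist (0 : X) (limitingSubdiff (fun y => (f y : EReal) + g y) w) ≤
      ENNReal.ofReal ((L + γ) * ‖w - u‖) := by
  have hv := npg_frechet f g hf hbot u w gw γ hgw hstep
  set v := gradient f w - gradient f u - γ • (w - u) with hvd
  have hm : v ∈ limitingSubdiff (fun y => (f y : EReal) + g y) w :=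
    ⟨fun _ => w, fun _ => v, tendsto_const_nhds, tendsto_const_nhds, tendsto_const_nhds, fun _ => hv⟩
  refine (Metric.infEDist_le_edist_of_mem hm).trans ?_
  rw [edist_dist, dist_zero_left]
  apply ENNReal.ofReal_le_ofReal
  calc ‖v‖ ≤ ‖gradient f w - gradient f u‖ + ‖γ • (w - u)‖ := norm_sub_le _ _
    _ ≤ (L + γ) * ‖w - u‖ := by
      rw [norm_smul, Real.norm_eq_abs, abs_of_nonneg hγ]; linarith

lemma npg_quad_bound {γ0 γh A K n : ℝ} (h0 : 0 < γ0) (hγ : γ0 ≤ γh) (hA : 0 ≤ A) (hn : 0 ≤ n)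
    (h : γh / 2 * n^2 ≤ A * n + K) : n ≤ 2 * (A + |K|) / γ0 + 1 := by
  by_contra hc
  push Not at hc
  have hK := le_abs_self K
  have hK0 := abs_nonneg K
  have h1 : 0 ≤ 2 * (A + |K|) / γ0 := by positivity
  have hn1 : 1 < n := by linarith
  have h2 : 2 * (A + |K|) / γ0 < n := by linarith
  rw [div_lt_iff₀ h0] at h2
  have h3 : γ0 / 2 * n^2 ≤ γh / 2 * n^2 := by gcongr
  have h4 : (A + |K|) * n < γ0/2 * n * n := by
    apply mul_lt_mul_of_pos_right _ (by linarith)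
    linarith
  nlinarith

/-- Local boundedness of the stepsizes. -/
lemma npg_gamma_bound (f : X → ℝ) (g : X → EReal) (hf : ContDiff ℝ 1 f)
    (hbot : ∀ y, g y ≠ ⊥)
    (hg_affine : ∃ (b : X) (c : ℝ), ∀ y, ((⟪b, y⟫ + c : ℝ) : EReal) ≤ g y)
    (hgrad_lip : LocallyLipschitz (fun y => gradient f y))
    (τ γmax δ : ℝ) (hτ : 1 < τ) (hγmax : 0 < γmax) (hδ : δ ∈ Set.Ioo (0:ℝ) 1) (Φ0 : ℝ)
    (xbar : X) (R : ℝ) :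
    ∃ Γ : ℝ, γmax ≤ Γ ∧ ∀ (u : X) (qu Φ γ : ℝ), u ∈ closedBall xbar R →
      (qu : EReal) = (f u : EReal) + g u → qu ≤ Φ → Φ ≤ Φ0 →
      (γmax < γ → ∃ xh : X,
      (∀ y : X, ((f u + ⟪gradient f u, xh - u⟫
          + (γ / τ) / 2 * ‖xh - u‖ ^ 2 : ℝ) : EReal) + g xh
        ≤ ((f u + ⟪gradient f u, y - u⟫
          + (γ / τ) / 2 * ‖y - u‖ ^ 2 : ℝ) : EReal) + g y)
      ∧ ((Φ - δ * γ / (2 * τ) * ‖xh - u‖ ^ 2 : ℝ) : EReal) < (f xh : EReal) + g xh) →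
      γ ≤ Γ := by
  obtain ⟨b, c, hbc⟩ := hg_affine
  have hK := isCompact_closedBall xbar R
  obtain ⟨Cf, hCf⟩ := hK.exists_bound_of_continuousOn hf.continuous.continuousOn
  obtain ⟨Cg, hCg⟩ := hK.exists_bound_of_continuousOn hgrad_lip.continuous.continuousOn
  set K := Φ0 + Cf + ‖b‖ * (‖xbar‖ + R) - c with hKd
  set A := |Cg| + ‖b‖ with hAd
  set N := 2 * (A + |K|) / (γmax/τ) + 1 with hNd
  obtain ⟨L, hL0, hL⟩ := npg_grad_lip f hgrad_lip xbar (R + N)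
  have hτ0 : 0 < τ := by linarith
  refine ⟨max γmax (τ * (2 * L / (1 - δ))), le_max_left _ _, ?_⟩
  intro u qu Φ γ hu hqu hqΦ hΦ htrial
  rcases le_or_gt γ γmax with h | h
  · exact h.trans (le_max_left _ _)
  apply le_max_of_le_right
  obtain ⟨xh, hmin, hrej⟩ := htrial h
  have hgu : g u = ((qu - f u : ℝ) : EReal) := by
    have : g u ≠ ⊤ := by
      intro ht
      rw [ht, EReal.coe_add_top] at hqu
      exact EReal.coe_ne_top _ hqu
    lift g u to ℝ using ⟨this, hbot u⟩ with gu
    norm_cast at hqu ⊢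
    linarith
  have hm := hmin u
  rw [hgu] at hm
  have hxt : g xh ≠ ⊤ := by
    intro ht
    rw [ht, EReal.coe_add_top, ← EReal.coe_add] at hm
    exact EReal.coe_ne_top _ (top_le_iff.1 hm)
  have hbx := hbc xh
  have hbotx := hbot xh
  lift g xh to ℝ using ⟨hxt, hbotx⟩ with gh
  norm_cast at hm hbx hrej
  rw [sub_self, inner_zero_right, norm_zero] at hm
  set n := ‖xh - u‖ with hn
  have hn0 : 0 ≤ n := norm_nonneg _
  have e : δ * γ / (2 * τ) = δ * (γ/τ) / 2 := by field_simp
  rw [e] at hrej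
  have hγh : γmax / τ ≤ γ / τ := by gcongr
  set γh := γ / τ with hγhd
  have hg0 : 0 < γmax / τ := by positivity
  have i1 : |⟪gradient f u, xh - u⟫| ≤ ‖gradient f u‖ * n := abs_real_inner_le_norm _ _
  have i2 : |⟪b, xh⟫| ≤ ‖b‖ * ‖xh‖ := abs_real_inner_le_norm _ _
  have i3 : ‖xh‖ ≤ n + (‖xbar‖ + R) := by
    have h1 : ‖xh‖ ≤ ‖xh - u‖ + ‖u‖ := by
      simpa using norm_add_le (xh - u) u
    have h2 : ‖u‖ ≤ ‖u - xbar‖ + ‖xbar‖ := by simpa using norm_add_le (u - xbar) xbar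
    have h3 : ‖u - xbar‖ ≤ R := by simpa [dist_eq_norm] using hu
    linarith
  have hcf := (abs_le.1 (hCf u hu)).1
  have hcg := (hCg u hu).trans (le_abs_self _)
  have hbound : γh / 2 * n^2 ≤ A * n + K := by
    have j1 := (abs_le.1 i1).1
    have j2 := (abs_le.1 i2).1
    have j3 := mul_le_mul_of_nonneg_left i3 (norm_nonneg b)
    have j4 := mul_le_mul_of_nonneg_right hcg hn0
    rw [hAd, hKd]
    nlinarith
  have hnN : n ≤ N := npg_quad_bound hg0 hγh (by positivity) hn0 hbound
  have hN0 : 0 ≤ N := hn0.trans hnN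
  have huB : u ∈ closedBall xbar (R + N) := closedBall_subset_closedBall (by linarith) hu
  have hxB : xh ∈ closedBall xbar (R + N) := by
    rw [mem_closedBall, dist_eq_norm] at hu ⊢
    have := norm_sub_le_norm_sub_add_norm_sub xh u xbar
    linarith
  have hdes := npg_descent f hf xbar (R+N) L hL0 hL u xh huB hxB
  have hlt : (1 - δ) * γh * n^2 < 2 * L * n^2 := by
    rw [← hn] at hdes
    nlinarith
  have hn2 : 0 < n^2 := by
    rcases hn0.eq_or_lt with h0 | h0
    · rw [← h0] at hlt; norm_num at hlt
    · positivity
  have hlt2 := lt_of_mul_lt_mul_right hlt hn2.le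
  have hδ1 : 0 < 1 - δ := by linarith [hδ.2]
  have : γh ≤ 2 * L / (1 - δ) := by
    rw [le_div_iff₀ hδ1]; linarith
  have hγe : γ = τ * γh := by rw [hγhd]; field_simp
  rw [hγe]
  exact mul_le_mul_of_nonneg_left this hτ0.le

end
theorem stmt11
    {X : Type*} [NormedAddCommGroup X] [InnerProductSpace ℝ X] [FiniteDimensional ℝ X]
    (f : X → ℝ) (g : X → EReal)
    (hf : ContDiff ℝ 1 f)
    (hg_lsc : LowerSemicontinuous g)
    (hg_proper : ∃ y, g y ≠ ⊤)
    (hq_bddbelow : ∃ c : ℝ, ∀ y, g y ≠ ⊤ → (c : EReal) ≤ (f y : EReal) + g y)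
    (hg_affine : ∃ (b : X) (c : ℝ), ∀ y, ((⟪b, y⟫ + c : ℝ) : EReal) ≤ g y)
    (hgrad_lip : LocallyLipschitz (fun y => gradient f y))
    (τ γmin γmax δ pmin : ℝ)
    (hτ : 1 < τ) (hγmin : 0 < γmin) (hγminmax : γmin ≤ γmax)
    (hδ : δ ∈ Set.Ioo (0:ℝ) 1) (hpmin : 4/5 ≤ pmin) (hpmin1 : pmin ≤ 1)
    (p : ℕ → ℝ) (hp : ∀ k, p k ∈ Set.Icc pmin 1)
    (x : ℕ → X) (γ : ℕ → ℝ) (Φ : ℕ → ℝ) (qx : ℕ → ℝ)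
    (hdom : ∀ k, g (x k) ≠ ⊤)
    (hqx : ∀ k, (qx k : EReal) = (f (x k) : EReal) + g (x k))
    (hγlb : ∀ k, γmin ≤ γ k)
    (hΦ0 : Φ 0 = qx 0)
    (hΦrec : ∀ k, Φ (k + 1) = (1 - p k) * Φ k + p k * qx (k + 1))
    (hstep : ∀ k, ∀ y : X,
      ((f (x k) + ⟪gradient f (x k), x (k + 1) - x k⟫
          + γ k / 2 * ‖x (k + 1) - x k‖ ^ 2 : ℝ) : EReal) + g (x (k + 1))
        ≤ ((f (x k) + ⟪gradient f (x k), y - x k⟫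
          + γ k / 2 * ‖y - x k‖ ^ 2 : ℝ) : EReal) + g y)
    (haccept : ∀ k, qx (k + 1) ≤ Φ k - δ * γ k / 2 * ‖x (k + 1) - x k‖ ^ 2)
    (htrial : ∀ k, γmax < γ k → ∃ xh : X,
      (∀ y : X, ((f (x k) + ⟪gradient f (x k), xh - x k⟫
          + (γ k / τ) / 2 * ‖xh - x k‖ ^ 2 : ℝ) : EReal) + g xh
        ≤ ((f (x k) + ⟪gradient f (x k), y - x k⟫
          + (γ k / τ) / 2 * ‖y - x k‖ ^ 2 : ℝ) : EReal) + g y)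
      ∧ ((Φ k - δ * γ k / (2 * τ) * ‖xh - x k‖ ^ 2 : ℝ) : EReal) < (f xh : EReal) + g xh)
    (hpmin45 : 4/5 < pmin)
    (xbar : X) (φ : ℕ → ℕ) (hφ : StrictMono φ)
    (hconv : Filter.Tendsto (fun j => x (φ j)) Filter.atTop (nhds xbar))
    (hKL : HasKLProperty (fun y => (f y : EReal) + g y) xbar) :
    Filter.Tendsto x Filter.atTop (nhds xbar) := by
  have hbot : ∀ y, g y ≠ ⊥ := by
    obtain ⟨b, c, h⟩ := hg_affine
    intro y hy
    have := h y
    rw [hy] at this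
    exact EReal.coe_ne_bot _ (le_bot_iff.1 this)
  have hgx : ∀ k, g (x k) = ((qx k - f (x k) : ℝ) : EReal) := by
    intro k
    have h1 := hqx k
    have h2 := hdom k
    have h3 := hbot (x k)
    lift g (x k) to ℝ using ⟨h2, h3⟩ with gu
    norm_cast at h1 ⊢
    linarith
  have hp0 : ∀ k, 4/5 ≤ p k := fun k => hpmin.trans (hp k).1
  have hγ0 : ∀ k, 0 < γ k := fun k => hγmin.trans_le (hγlb k)
  have hacc0 : ∀ k, 0 ≤ δ * γ k / 2 * ‖x (k + 1) - x k‖ ^ 2 := by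
    intro k
    have := hγ0 k
    have := hδ.1
    positivity
  have hqΦ : ∀ k, qx k ≤ Φ k := by
    intro k
    cases k with
    | zero => exact hΦ0.ge
    | succ k =>
      rw [hΦrec]
      have h1 := haccept k
      have h2 := hacc0 k
      have h3 := (hp k).2
      nlinarith
  set c := 4/5 * (δ * γmin / 2) with hcdef
  have hcpos : 0 < c := by
    have := hδ.1
    positivity
  have hdec : ∀ k, c * ‖x (k+1) - x k‖^2 ≤ Φ k - Φ (k+1) := by
    intro k
    rw [hΦrec]
    have h1 := haccept k
    have h2 := hacc0 k
    have h3 := hp0 k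
    have h4 : δ * γmin / 2 * ‖x (k + 1) - x k‖ ^ 2 ≤ δ * γ k / 2 * ‖x (k + 1) - x k‖ ^ 2 := by
      have := hγlb k
      have := hδ.1
      gcongr
    have h5 : 4/5 * (δ * γ k / 2 * ‖x (k + 1) - x k‖ ^ 2) ≤ p k * (Φ k - qx (k+1)) :=
      mul_le_mul h3 (by linarith) h2 (by linarith)
    rw [hcdef]
    nlinarith
  have hanti : Antitone Φ := antitone_nat_of_succ_le (fun k => by
    have := hdec k
    have : 0 ≤ c * ‖x (k+1) - x k‖^2 := by positivity
    linarith)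
  have hbdd : BddBelow (Set.range Φ) := by
    obtain ⟨c0, hc0⟩ := hq_bddbelow
    refine ⟨c0, ?_⟩
    rintro _ ⟨k, rfl⟩
    have := hc0 (x k) (hdom k)
    rw [← hqx k] at this
    exact (EReal.coe_le_coe_iff.1 this).trans (hqΦ k)
  set Φs := ⨅ k, Φ k with hΦs
  have hlim : Tendsto Φ atTop (𝓝 Φs) := tendsto_atTop_ciInf hanti hbdd
  have hge : ∀ k, Φs ≤ Φ k := fun k => ciInf_le hbdd k
  have hlim1 : Tendsto (fun k => Φ (k+1)) atTop (𝓝 Φs) := hlim.comp (tendsto_add_atTop_nat 1)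
  have hdiff0 : Tendsto (fun k => Φ k - Φ (k+1)) atTop (𝓝 0) := by
    simpa using hlim.sub hlim1
  have hd : Tendsto (fun k => ‖x (k+1) - x k‖) atTop (𝓝 0) := by
    have h1 : Tendsto (fun k => √((Φ k - Φ (k+1)) / c)) atTop (𝓝 0) := by
      have := (hdiff0.div_const c).sqrt
      simpa using this
    refine squeeze_zero (fun k => norm_nonneg _) (fun k => ?_) h1
    apply Real.le_sqrt_of_sq_le
    rw [le_div_iff₀ hcpos]
    linarith [hdec k]
  have hqlim1 : Tendsto (fun k => qx (k+1)) atTop (𝓝 Φs) := by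
    have h1 : Tendsto (fun k => Φ k - 5/4 * (Φ k - Φ (k+1))) atTop (𝓝 Φs) := by
      simpa using hlim.sub (hdiff0.const_mul (5/4))
    refine tendsto_of_tendsto_of_tendsto_of_le_of_le h1 hlim (fun k => ?_) (fun k => ?_)
    · have h3 := hp0 k
      have h2 := haccept k
      have h4 := hacc0 k
      have h5 := hΦrec k
      show Φ k - 5/4 * (Φ k - Φ (k+1)) ≤ qx (k+1)
      nlinarith
    · have h2 := haccept k
      have h4 := hacc0 k
      show qx (k+1) ≤ Φ k
      linarith
  have hqlim : Tendsto qx atTop (𝓝 Φs) := (tendsto_add_atTop_iff_nat 1).1 hqlim1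
  have hφt := hφ.tendsto_atTop
  -- value at the limit point
  have hle : (f xbar : EReal) + g xbar ≤ (Φs : EReal) := by
    by_contra hcon
    have hgx' : ((Φs - f xbar : ℝ) : EReal) < g xbar := by
      by_contra h
      push Not at h
      apply hcon
      have h1 : g xbar ≠ ⊤ := ne_top_of_le_ne_top (EReal.coe_ne_top _) h
      have h2 := hbot xbar
      lift g xbar to ℝ using ⟨h1, h2⟩ with gb
      norm_cast at h ⊢
      linarith
    obtain ⟨z, hz1, hz2⟩ := EReal.lt_iff_exists_real_btwn.1 hgx'
    have hz1' : Φs - f xbar < z := by exact_mod_cast hz1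
    have ev1 := hconv.eventually (hg_lsc xbar z hz2)
    have t1 : Tendsto (fun j => qx (φ j) - f (x (φ j))) atTop (𝓝 (Φs - f xbar)) :=
      (hqlim.comp hφt).sub ((hf.continuous.tendsto xbar).comp hconv)
    have ev2 := t1.eventually (gt_mem_nhds hz1')
    obtain ⟨j, h1, h2⟩ := (ev1.and ev2).exists
    have h1' : (z : EReal) < g (x (φ j)) := h1
    rw [hgx] at h1'
    have := EReal.coe_lt_coe_iff.1 h1'
    linarith
  have hgbt : g xbar ≠ ⊤ := by
    intro h
    rw [h, EReal.coe_add_top] at hle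
    exact EReal.coe_ne_top _ (top_le_iff.1 hle)
  obtain ⟨gb, hgb⟩ : ∃ r : ℝ, g xbar = r :=
    ⟨(g xbar).toReal, (EReal.coe_toReal hgbt (hbot xbar)).symm⟩
  obtain ⟨η, χ, χ', hη, hχ0, hχnn, hχc, hχcc, _, hχd, U, hU, hKLU⟩ := hKL
  obtain ⟨R, hR, hRU⟩ := Metric.mem_nhds_iff.1 hU
  obtain ⟨Γ, hΓ, hγΓ'⟩ := npg_gamma_bound f g hf hbot hg_affine hgrad_lip τ γmax δ hτ
    (hγmin.trans_le hγminmax) hδ (Φ 0) xbar R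
  have hγΓ : ∀ k, x k ∈ closedBall xbar R → γ k ≤ Γ := fun k hk =>
    hγΓ' (x k) (qx k) (Φ k) (γ k) hk (hqx k) (hqΦ k) (hanti (Nat.zero_le k)) (htrial k)
  have hΓ0 : 0 < Γ := (hγmin.trans_le hγminmax).trans_le hΓ
  have hval : f xbar + gb = Φs := by
    apply le_antisymm
    · rw [hgb] at hle
      exact_mod_cast hle
    · -- limit in the model inequality
      have hcg : Continuous (fun y => gradient f y) := hgrad_lip.continuous
      have hx1 : Tendsto (fun j => x (φ j + 1)) atTop (𝓝 xbar) := by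
        have h0 : Tendsto (fun j => x (φ j + 1) - x (φ j)) atTop (𝓝 0) :=
          tendsto_zero_iff_norm_tendsto_zero.2 (hd.comp hφt)
        simpa using h0.add hconv
      have tl : Tendsto (fun j => ⟪gradient f (x (φ j)), x (φ j + 1) - x (φ j)⟫
          + (qx (φ j + 1) - f (x (φ j + 1)))) atTop
          (𝓝 (⟪gradient f xbar, xbar - xbar⟫ + (Φs - f xbar))) :=
        (((hcg.tendsto xbar).comp hconv).inner (hx1.sub hconv)).add
          ((hqlim1.comp hφt).sub ((hf.continuous.tendsto xbar).comp hx1))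
      have tr : Tendsto (fun j => ⟪gradient f (x (φ j)), xbar - x (φ j)⟫
          + Γ / 2 * ‖xbar - x (φ j)‖^2 + gb) atTop
          (𝓝 (⟪gradient f xbar, xbar - xbar⟫ + Γ / 2 * ‖xbar - xbar‖^2 + gb)) :=
        ((((hcg.tendsto xbar).comp hconv).inner (tendsto_const_nhds.sub hconv)).add
          (((tendsto_const_nhds.sub hconv).norm.pow 2).const_mul _)).add tendsto_const_nhds
      have hfin := le_of_tendsto_of_tendsto tl tr (by
        filter_upwards [hconv.eventually (closedBall_mem_nhds xbar hR)] with j hj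
        have h1 := hstep (φ j) xbar
        rw [hgx, hgb] at h1
        norm_cast at h1
        have h2 := hγΓ (φ j) hj
        have h3 : γ (φ j) / 2 * ‖xbar - x (φ j)‖^2 ≤ Γ / 2 * ‖xbar - x (φ j)‖^2 := by gcongr
        have h4 : 0 ≤ γ (φ j) / 2 * ‖x (φ j + 1) - x (φ j)‖^2 := by
          have := hγ0 (φ j)
          positivity
        linarith)
      simp at hfin
      linarith
  have hqbar : (f xbar : EReal) + g xbar = (Φs : EReal) := by
    rw [hgb, ← hval]; norm_cast
  obtain ⟨L, hL0, hL⟩ := npg_grad_lip f hgrad_lip xbar R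
  set M := L + Γ with hM
  have hM0 : 0 ≤ M := by positivity
  have haη : ∀ᶠ k in atTop, Φ k - Φs < η := by
    have : Tendsto (fun k => Φ k - Φs) atTop (𝓝 0) := by
      simpa using hlim.sub_const Φs
    exact this.eventually (gt_mem_nhds hη)
  obtain ⟨K0, hK0⟩ := eventually_atTop.1 haη
  set E : ℕ → ℝ := fun k => M/c * χ ((Φ (k+1) - Φs)/2) + 2/√c * √(Φ k - Φs) with hE
  set V : ℕ → ℝ := fun k => ‖x (k+1) - x k‖ + 2 * E k with hV
  have hmem : ∀ k, K0 ≤ k → (Φ (k+1) - Φs)/2 ∈ Set.Icc 0 η := by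
    intro k hk
    have h1 := hK0 (k+1) (by omega)
    have h2 := hge (k+1)
    exact ⟨by linarith, by linarith⟩
  have hElim : Tendsto E atTop (𝓝 0) := by
    have t1 : Tendsto (fun k => χ ((Φ (k+1) - Φs)/2)) atTop (𝓝 0) := by
      have hc0 := hχc 0 ⟨le_rfl, hη.le⟩
      rw [ContinuousWithinAt, hχ0] at hc0
      refine hc0.comp (tendsto_nhdsWithin_iff.2 ⟨?_, ?_⟩)
      · simpa using (hlim1.sub_const Φs).div_const 2
      · exact eventually_atTop.2 ⟨K0, hmem⟩
    have t2 : Tendsto (fun k => √(Φ k - Φs)) atTop (𝓝 0) := by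
      simpa using (hlim.sub_const Φs).sqrt
    simpa using (t1.const_mul (M/c)).add (t2.const_mul (2/√c))
  have hVlim : Tendsto V atTop (𝓝 0) := by
    simpa using hd.add (hElim.const_mul 2)
  refine npg_abs_conv x xbar V φ hφ K0 R hR hconv hd hVlim ?_ ?_
  · intro k hk
    have h1 := hχnn _ (hmem k hk)
    simp only [hV, hE]
    positivity
  · intro k hk hk1 hk2
    have hB1 : x k ∈ closedBall xbar R := by
      rw [mem_closedBall, dist_eq_norm]; exact hk1.le
    have hB2 : x (k+1) ∈ closedBall xbar R := by
      rw [mem_closedBall, dist_eq_norm]; exact hk2.le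
    have hkey := npg_step_ineq (a := Φ k - Φs) (a1 := Φ (k+1) - Φs) (a2 := Φ (k+2) - Φs)
      (r := qx (k+1) - Φs) (p := p k) (d := ‖x (k+1) - x k‖) (d1 := ‖x (k+2) - x (k+1)‖)
      (c := c) (M := M) hχcc hχc hχd hcpos hM0 (hp0 k) (hp k).2 (by linarith [hge (k+2)])
      (by linarith [hanti (show k+1 ≤ k+2 by omega)]) (by linarith [hanti (show k ≤ k+1 by omega)])
      (hK0 (k+1) (by omega)) (norm_nonneg _) (norm_nonneg _)
      (by rw [hΦrec]; ring) (by linarith [hqΦ (k+1)]) (by linarith [hdec (k+1)])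
      (by
        intro hr hrη
        have hy := hKLU (x (k+1)) (hRU (by rw [mem_ball, dist_eq_norm]; exact hk2))
        simp only [hqbar, ← hqx (k+1)] at hy
        have hy' := hy (by exact_mod_cast (by linarith : Φs < qx (k+1)))
          (by exact_mod_cast (by linarith : qx (k+1) < Φs + η))
        rw [← EReal.coe_sub, EReal.toReal_coe] at hy'
        have hdist := npg_infEdist f g hf hbot (x k) (x (k+1)) _ (γ k) L (hγ0 k).le (hgx (k+1))
          (hL _ hB2 _ hB1) (hstep k)
        have hpos := (hχd _ ⟨hr, hrη⟩).2
        have hy2 := hy'.trans (mul_le_mul_right hdist _)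
        rw [← ENNReal.ofReal_mul hpos.le, ENNReal.one_le_ofReal] at hy2
        refine hy2.trans (mul_le_mul_of_nonneg_left ?_ hpos.le)
        exact mul_le_mul_of_nonneg_right (by linarith [hγΓ k hB1]) (norm_nonneg _))
    simp only [hV, hE]
    have e : k + 1 + 1 = k + 2 := rfl
    rw [e]
    linarith
end
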